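/- Let p, q be nonnegative integers, n = (p+1)(q+1), let A ⊂ ℤ≥0² be a finite set and S a lower set with |S| = n·|A|. Then S = R^{p,q} for some lower set R if and only if n_{p,q}(S) ≤ |A|, and in that case n_{p,q}(S) = |A|. -/

import Mathlib

open Finset

/-- A finite subset of `ℤ≥0²` is a *lower set* if it is closed under
coordinatewise decrease. -/
def IsLower (S : Finset (ℕ × ℕ)) : Prop :=
  ∀ u v, (u, v) ∈ S → ∀ i j, i ≤ u → j ≤ v → (i, j) ∈ S

/-- The value at `(x,y)` of `∂^{i+j}P/∂x^i∂y^j`, where `P` is the polynomial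
with coefficients `a` supported on `S`. -/
noncomputable def derivAt (S : Finset (ℕ × ℕ)) (a : ℕ × ℕ → ℝ) (i j : ℕ) (x y : ℝ) : ℝ :=
  ∑ uv ∈ S, a uv * (uv.1.descFactorial i : ℝ) * (uv.2.descFactorial j : ℝ) *
      x ^ (uv.1 - i) * y ^ (uv.2 - j)

/-- The bivariate Birkhoff scheme `(Z,A,S)` is *regular*: every interpolation
problem has a unique solution in `P_S` (polynomials supported on `S`). -/
def Regular (Z : Finset (ℝ × ℝ)) (A S : Finset (ℕ × ℕ)) : Prop :=
  ∀ c : ℕ × ℕ → ℝ × ℝ → ℝ, ∃! a : ℕ × ℕ → ℝ,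
    (∀ uv, uv ∉ S → a uv = 0) ∧
    ∀ z ∈ Z, ∀ ij ∈ A, derivAt S a ij.1 ij.2 z.1 z.2 = c ij z

/-- The scheme `(Z,A,S)` is *solvable*: every interpolation problem has at
least one solution in `P_S`. -/
def Solvable (Z : Finset (ℝ × ℝ)) (A S : Finset (ℕ × ℕ)) : Prop :=
  ∀ c : ℕ × ℕ → ℝ × ℝ → ℝ, ∃ a : ℕ × ℕ → ℝ,
    (∀ uv, uv ∉ S → a uv = 0) ∧
    ∀ z ∈ Z, ∀ ij ∈ A, derivAt S a ij.1 ij.2 z.1 z.2 = c ij z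

/-- `Z ⊂ ℝ²` is a `(p,q)`-rectangular set of nodes. -/
def IsRect (p q : ℕ) (Z : Finset (ℝ × ℝ)) : Prop :=
  ∃ x : Fin (p + 1) → ℝ, ∃ y : Fin (q + 1) → ℝ,
    Function.Injective x ∧ Function.Injective y ∧
    Z = (Finset.univ : Finset (Fin (p + 1) × Fin (q + 1))).image (fun ij => (x ij.1, y ij.2))

/-- `B_x = {i : (i,0) ∈ B}`. -/
def setX (B : Finset (ℕ × ℕ)) : Finset ℕ := (B.filter fun ij => ij.2 = 0).image Prod.fst

/-- `B_y = {j : (0,j) ∈ B}`. -/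
def setY (B : Finset (ℕ × ℕ)) : Finset ℕ := (B.filter fun ij => ij.1 = 0).image Prod.snd

/-- `B_x[β] = {α : (α,β) ∈ B}`. -/
def sliceX (B : Finset (ℕ × ℕ)) (b : ℕ) : Finset ℕ := (B.filter fun ij => ij.2 = b).image Prod.fst

/-- `B_y[α] = {β : (α,β) ∈ B}`. -/
def sliceY (B : Finset (ℕ × ℕ)) (a : ℕ) : Finset ℕ := (B.filter fun ij => ij.1 = a).image Prod.snd

/-- Projection of the nodes on the OX axis. -/
noncomputable def nodesX (Z : Finset (ℝ × ℝ)) : Finset ℝ := Z.image Prod.fst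

/-- Projection of the nodes on the OY axis. -/
noncomputable def nodesY (Z : Finset (ℝ × ℝ)) : Finset ℝ := Z.image Prod.snd

/-- The rectangle `R(u,v) = {(i,j) : i ≤ u, j ≤ v}`. -/
def rect (u v : ℕ) : Finset (ℕ × ℕ) := Finset.range (u + 1) ×ˢ Finset.range (v + 1)

/-- The blow-up `R^{p,q} = {(α,β) : (⌊α/(p+1)⌋, ⌊β/(q+1)⌋) ∈ R}`. -/
def blowup (p q : ℕ) (R : Finset (ℕ × ℕ)) : Finset (ℕ × ℕ) :=
  (R ×ˢ (Finset.range (p + 1) ×ˢ Finset.range (q + 1))).image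
    (fun x => ((p + 1) * x.1.1 + x.2.1, (q + 1) * x.1.2 + x.2.2))

/-- `n_{p,q}(L)`: number of `(α,β) ∈ L` with `(p+1) ∣ α` and `(q+1) ∣ β`. -/
def npq (p q : ℕ) (L : Finset (ℕ × ℕ)) : ℕ :=
  (L.filter fun ab => (p + 1) ∣ ab.1 ∧ (q + 1) ∣ ab.2).card

/-- Value at `x` of the `i`-th derivative of the univariate polynomial with
coefficients `a` supported on `S`. -/
noncomputable def derivAt1 (S : Finset ℕ) (a : ℕ → ℝ) (i : ℕ) (x : ℝ) : ℝ :=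
  ∑ u ∈ S, a u * (u.descFactorial i : ℝ) * x ^ (u - i)

/-- Regularity of the univariate Birkhoff scheme `(W,A,S)`. -/
def Regular1 (W : Finset ℝ) (A S : Finset ℕ) : Prop :=
  ∀ c : ℕ → ℝ → ℝ, ∃! a : ℕ → ℝ,
    (∀ u, u ∉ S → a u = 0) ∧
    ∀ w ∈ W, ∀ i ∈ A, derivAt1 S a i w = c i w

/-- `(A,S)` is almost regular with respect to `(p,q)`-rectangular sets of nodes. -/
def AlmostRegular (p q : ℕ) (A S : Finset (ℕ × ℕ)) : Prop :=
  ∃ Z : Finset (ℝ × ℝ), IsRect p q Z ∧ Regular Z A S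


theorem mem_blowup {p q : ℕ} {R : Finset (ℕ × ℕ)} {x : ℕ × ℕ} :
    x ∈ blowup p q R ↔ (x.1 / (p + 1), x.2 / (q + 1)) ∈ R := by
  obtain ⟨a, b⟩ := x
  simp only [blowup, mem_image, mem_product, mem_range]
  constructor
  · rintro ⟨⟨⟨u, v⟩, i, j⟩, ⟨hR, hi, hj⟩, h⟩
    obtain ⟨rfl, rfl⟩ := Prod.mk.inj h
    simpa [Nat.mul_add_div, Nat.div_eq_of_lt hi, Nat.div_eq_of_lt hj] using hR
  · intro h
    exact ⟨⟨(a / (p + 1), b / (q + 1)), a % (p + 1), b % (q + 1)⟩,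
      ⟨h, Nat.mod_lt _ p.succ_pos, Nat.mod_lt _ q.succ_pos⟩,
      Prod.ext (Nat.div_add_mod _ _) (Nat.div_add_mod _ _)⟩

theorem card_blowup (p q : ℕ) (R : Finset (ℕ × ℕ)) :
    (blowup p q R).card = (p + 1) * (q + 1) * R.card := by
  rw [blowup, card_image_of_injOn]
  · simp only [card_product, card_range]
    ring
  · rintro ⟨⟨u, v⟩, i, j⟩ h ⟨⟨u', v'⟩, i', j'⟩ h' he
    simp only [coe_product, Set.mem_prod, mem_coe, mem_range] at h h'
    obtain ⟨h1, h2⟩ := Prod.mk.inj he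
    have hu := congrArg (· / (p + 1)) h1
    have hv := congrArg (· / (q + 1)) h2
    simp only [Nat.mul_add_div p.succ_pos, Nat.mul_add_div q.succ_pos,
      Nat.div_eq_of_lt h.2.1, Nat.div_eq_of_lt h.2.2,
      Nat.div_eq_of_lt h'.2.1, Nat.div_eq_of_lt h'.2.2, add_zero] at hu hv
    subst hu hv
    simp_all

/-- The set of `(a, b)` such that `((p + 1) a, (q + 1) b) ∈ S`. -/
def contraction (p q : ℕ) (S : Finset (ℕ × ℕ)) : Finset (ℕ × ℕ) :=
  (S.filter fun ab => (p + 1) ∣ ab.1 ∧ (q + 1) ∣ ab.2).image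
    fun ab => (ab.1 / (p + 1), ab.2 / (q + 1))

theorem mem_contraction {p q : ℕ} {S : Finset (ℕ × ℕ)} {x : ℕ × ℕ} :
    x ∈ contraction p q S ↔ ((p + 1) * x.1, (q + 1) * x.2) ∈ S := by
  simp only [contraction, mem_image, mem_filter]
  constructor
  · rintro ⟨⟨a, b⟩, ⟨hS, ha, hb⟩, rfl⟩
    simpa only [Nat.mul_div_cancel' ha, Nat.mul_div_cancel' hb] using hS
  · intro h
    exact ⟨_, ⟨h, dvd_mul_right _ _, dvd_mul_right _ _⟩, by simp⟩

theorem card_contraction (p q : ℕ) (S : Finset (ℕ × ℕ)) :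
    (contraction p q S).card = npq p q S := by
  refine card_image_of_injOn ?_
  rintro ⟨a, b⟩ h ⟨a', b'⟩ h' he
  simp only [coe_filter, Set.mem_ofPred_eq] at h h'
  obtain ⟨h1, h2⟩ := Prod.mk.inj he
  exact Prod.ext ((Nat.div_left_inj h.2.1 h'.2.1).1 h1) ((Nat.div_left_inj h.2.2 h'.2.2).1 h2)

theorem contraction_blowup (p q : ℕ) (R : Finset (ℕ × ℕ)) :
    contraction p q (blowup p q R) = R := by
  ext x
  simp [mem_contraction, mem_blowup]

theorem npq_blowup (p q : ℕ) (R : Finset (ℕ × ℕ)) : npq p q (blowup p q R) = R.card := by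
  rw [← card_contraction, contraction_blowup]

theorem IsLower.contraction {S : Finset (ℕ × ℕ)} (hS : IsLower S) (p q : ℕ) :
    IsLower (contraction p q S) := fun _ _ h _ _ hi hj =>
  mem_contraction.2 (hS _ _ (mem_contraction.1 h) _ _
    (Nat.mul_le_mul_left _ hi) (Nat.mul_le_mul_left _ hj))

theorem IsLower.subset_blowup_contraction {S : Finset (ℕ × ℕ)} (hS : IsLower S) (p q : ℕ) :
    S ⊆ blowup p q (_root_.contraction p q S) := fun _ h =>
  mem_blowup.2 (mem_contraction.2 (hS _ _ h _ _ (Nat.mul_div_le _ _) (Nat.mul_div_le _ _)))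

/-- with `|S| = (p+1)(q+1)|A|`, `S` is a blow-up `R^{p,q}` of a
lower set `R` iff `n_{p,q}(S) ≤ |A|`, in which case equality holds. -/
theorem blowup_iff_npq (p q : ℕ) (A S : Finset (ℕ × ℕ))
    (hS : IsLower S) (hcard : S.card = (p + 1) * (q + 1) * A.card) :
    ((∃ R : Finset (ℕ × ℕ), IsLower R ∧ S = blowup p q R) ↔ npq p q S ≤ A.card) ∧
    (npq p q S ≤ A.card → npq p q S = A.card) := by
  have key : npq p q S ≤ A.card → S = blowup p q (contraction p q S) := fun h =>
    eq_of_subset_of_card_le (hS.subset_blowup_contraction p q) <| by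
      rw [card_blowup, card_contraction, hcard]
      exact Nat.mul_le_mul_left _ h
  have card_eq (R : Finset (ℕ × ℕ)) (hR : S = blowup p q R) : npq p q S = A.card := by
    rw [hR, card_blowup] at hcard
    rw [hR, npq_blowup]
    exact Nat.eq_of_mul_eq_mul_left (by positivity) hcard
  exact ⟨⟨fun ⟨R, _, hR⟩ => (card_eq R hR).le, fun h => ⟨_, hS.contraction p q, key h⟩⟩,
    fun h => card_eq _ (key h)⟩
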